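/- For every ordinal α with 1 ≤ α < ω₁ there exists a closed set F ⊆ ω^ω × ω^ω such that for every x ∈ ω^ω the section F_x contains exactly two points and there is no function f : ω^ω → ω^ω whose graph {(x, f(x)) : x ∈ ω^ω} is a subset of F belonging to the additive Borel class Σ⁰_α(ω^ω × ω^ω). -/

import Mathlib

/-- The additive Borel class `Σ⁰_α(Z)` of a topological space `Z`. -/
noncomputable def Sigma0 (Z : Type*) [TopologicalSpace Z] (α : Ordinal) : Set (Set Z) :=
  {s | (α = 1 ∧ IsOpen s) ∨
       (1 < α ∧ ∃ A : ℕ → Set Z, ∃ β : ℕ → Ordinal,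
          (∀ n : ℕ, 1 ≤ β n ∧ ∃ hb : β n < α, A n ∈ Sigma0 Z (β n)) ∧ s = ⋃ n, (A n)ᶜ)}
termination_by α
decreasing_by exact hb

universe u

/-- `Anc p a b`: iterating `p` from `b` reaches `a`. -/
inductive Anc (p : ℕ → ℕ) : ℕ → ℕ → Prop
  | refl (a : ℕ) : Anc p a a
  | step {a b : ℕ} : Anc p a (p b) → Anc p a b

namespace Anc

variable {p : ℕ → ℕ} {a b c : ℕ}

theorem trans (h₁ : Anc p a b) (h₂ : Anc p b c) : Anc p a c := by
  induction h₂ with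
  | refl => exact h₁
  | step _ ih => exact .step ih

theorem eq_or (h : Anc p a b) : a = b ∨ Anc p a (p b) := by
  cases h with
  | refl => exact .inl rfl
  | step h => exact .inr h

theorem parent (b : ℕ) : Anc p (p b) b := .step (.refl _)

theorem le_of_forall_le (hp : ∀ m ≤ b, p m ≤ m) (h : Anc p a b) : a ≤ b := by
  induction h with
  | refl => exact le_rfl
  | step _ ih =>
    rename_i b _
    exact (ih fun m hm => hp m (hm.trans (hp b le_rfl))).trans (hp b le_rfl)

theorem le (hp : ∀ m, p m ≤ m) (h : Anc p a b) : a ≤ b := h.le_of_forall_le fun m _ => hp m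

theorem mem_of_mem {Y : Set ℕ} (hY : ∀ n ∈ Y, p n ∈ Y) (h : Anc p a b) (hb : b ∈ Y) : a ∈ Y := by
  induction h with
  | refl => exact hb
  | step _ ih => exact ih (hY _ hb)

end Anc

/-- The level-`β` parent function of the base parent function `p0`: at a node `n` with target `u`
and label `ε < β`, jump to the base parent of `u`. -/
noncomputable def lvl (p0 : ℕ → ℕ) (tg : ℕ → Option (ℕ × Ordinal)) (β : Ordinal) (n : ℕ) : ℕ :=
  open Classical in
  match tg n with
  | none => p0 n
  | some (u, ε) => if ε < β then p0 u else p0 n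

section Levels

variable {p0 : ℕ → ℕ} {tg : ℕ → Option (ℕ × Ordinal)} {α β γ δ : Ordinal}

theorem lvl_of_lt {n u : ℕ} {ε : Ordinal} (h : tg n = some (u, ε)) (hε : ε < β) :
    lvl p0 tg β n = p0 u := by
  simp [lvl, h, hε]

theorem lvl_of_le {n : ℕ} (h : ∀ u ε, tg n = some (u, ε) → β ≤ ε) :
    lvl p0 tg β n = p0 n := by
  unfold lvl
  split
  · rfl
  · rename_i u ε he
    rw [if_neg (not_lt.2 (h u ε he))]

theorem lvl_of_le' {n u : ℕ} {ε : Ordinal} (h : tg n = some (u, ε)) (hε : β ≤ ε) :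
    lvl p0 tg β n = p0 n :=
  lvl_of_le fun u' ε' h' => by
    rw [h] at h'
    simp only [Option.some.injEq, Prod.mk.injEq] at h'
    exact h'.2 ▸ hε

theorem label_cases (tg : ℕ → Option (ℕ × Ordinal)) (β : Ordinal) (n : ℕ) :
    (∃ u ε, tg n = some (u, ε) ∧ ε < β) ∨ ∀ u ε, tg n = some (u, ε) → β ≤ ε := by
  by_contra! h
  obtain ⟨h₁, u, ε, h₂, h₃⟩ := h
  exact absurd h₃ (not_lt.2 (h₁ u ε h₂))

theorem lvl_zero : lvl p0 tg 0 = p0 :=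
  funext fun _ => lvl_of_le fun _ _ _ => zero_le

/-- Coherence of the base parent function with targets and labels below `α`. -/
structure Good (p0 : ℕ → ℕ) (tg : ℕ → Option (ℕ × Ordinal)) (α : Ordinal) : Prop where
  le : ∀ n, p0 n ≤ n
  lt_bound : ∀ {n u ε}, tg n = some (u, ε) → ε < α
  parent_lt : ∀ {n u ε}, tg n = some (u, ε) → p0 n < n
  parent_target_lt : ∀ {n u ε}, tg n = some (u, ε) → p0 u < u
  anc_target : ∀ {n u ε}, tg n = some (u, ε) → Anc (lvl p0 tg α) u (p0 n)
  label_lt : ∀ {n u ε u' ε'}, tg n = some (u, ε) → tg u = some (u', ε') → ε < ε'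

namespace Good

variable (G : Good p0 tg α)
include G

theorem lvl_le_self (β : Ordinal) (n : ℕ) : lvl p0 tg β n ≤ n := by
  induction n using Nat.strong_induction_on generalizing β with
  | _ n ih =>
    rcases label_cases tg β n with ⟨u, ε, h, hε⟩ | h
    · rw [lvl_of_lt h hε]
      have h₁ := G.parent_lt h
      have h₂ := G.parent_target_lt h
      have h₃ := (G.anc_target h).le_of_forall_le fun m hm => ih m (hm.trans_lt h₁) α
      omega
    · rw [lvl_of_le h]
      exact G.le n

theorem anc_le {s t : ℕ} (h : Anc (lvl p0 tg β) s t) : s ≤ t := h.le (G.lvl_le_self β)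

theorem target_le {n u : ℕ} {ε : Ordinal} (h : tg n = some (u, ε)) : u ≤ p0 n :=
  G.anc_le (G.anc_target h)

theorem lvl_lt {n : ℕ} (h : p0 n < n) : lvl p0 tg β n < n := by
  rcases label_cases tg β n with ⟨u, ε, h', hε⟩ | h'
  · rw [lvl_of_lt h' hε]
    have := G.target_le h'
    have := G.parent_target_lt h'
    omega
  · rwa [lvl_of_le h']

theorem anc_lvl (hβγ : β ≤ γ) (hγ : γ ≤ α) (t : ℕ) : Anc (lvl p0 tg β) (lvl p0 tg γ t) t := by
  induction t using Nat.strong_induction_on generalizing γ with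
  | _ t ih =>
    rcases label_cases tg γ t with ⟨u, ε, h, hε⟩ | h
    · rcases lt_or_ge ε β with h' | h'
      · rw [lvl_of_lt h hε, ← lvl_of_lt (p0 := p0) h h']
        exact Anc.parent t
      · have key : ∀ {v}, Anc (lvl p0 tg α) u v → v ≤ p0 t → Anc (lvl p0 tg β) u v := by
          intro v hv
          induction hv with
          | refl => exact fun _ => .refl _
          | step _ ih' =>
            rename_i b _
            intro hb
            exact (ih' ((G.lvl_le_self α b).trans hb)).trans
              (ih b (hb.trans_lt (G.parent_lt h)) (hβγ.trans hγ) le_rfl)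
        have hu : lvl p0 tg β u = p0 u := lvl_of_le fun u' ε' h'' =>
          h'.trans (G.label_lt h h'').le
        rw [lvl_of_lt h hε, ← hu]
        refine (Anc.parent u).trans ((key (G.anc_target h) le_rfl).trans ?_)
        rw [← lvl_of_le' (p0 := p0) h h']
        exact Anc.parent t
    · rw [lvl_of_le h, ← lvl_of_le (p0 := p0) fun u ε h' => hβγ.trans (h u ε h')]
      exact Anc.parent t

theorem anc_mono (hβγ : β ≤ γ) (hγ : γ ≤ α) {s t : ℕ} (h : Anc (lvl p0 tg γ) s t) :
    Anc (lvl p0 tg β) s t := by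
  induction h with
  | refl => exact .refl _
  | step _ ih => exact ih.trans (G.anc_lvl hβγ hγ _)

theorem anc_succ_of_le (hδ : δ < α) {s n t : ℕ} (h₁ : Anc (lvl p0 tg (Order.succ δ)) s t)
    (h₂ : Anc (lvl p0 tg δ) n t) (hsn : s ≤ n) : Anc (lvl p0 tg (Order.succ δ)) s n := by
  induction h₂ with
  | refl => exact h₁
  | step h₂ ih =>
    rename_i b
    have hb := G.lvl_le_self δ b
    have hn := G.anc_le h₂
    rcases h₁.eq_or with rfl | h₁
    · obtain rfl : s = n := by omega
      exact .refl _
    apply ih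
    rcases label_cases tg δ b with ⟨u, ε, h, hε⟩ | h
    · rw [lvl_of_lt h hε]
      rwa [lvl_of_lt h (hε.trans (Order.lt_succ δ))] at h₁
    · rw [lvl_of_le h]
      rcases label_cases tg (Order.succ δ) b with ⟨u, ε, h', hε⟩ | h'
      · rw [lvl_of_lt h' hε] at h₁
        have hu : lvl p0 tg (Order.succ δ) u = p0 u := lvl_of_le fun u' ε' h'' =>
          Order.succ_le_of_lt ((h _ _ h').trans_lt (G.label_lt h' h''))
        rw [← hu] at h₁
        exact (h₁.trans (Anc.parent u)).trans
          (G.anc_mono (Order.succ_le_of_lt hδ) le_rfl (G.anc_target h'))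
      · rwa [lvl_of_le h'] at h₁

end Good

/-- The nodes of `Y` surviving the removals made at levels below `β`: a surviving node `n` with
target `u` and label `γ` removes the interval `[u, n)`. -/
def survivors (tg : ℕ → Option (ℕ × Ordinal)) (Y : Set ℕ) (β : Ordinal) : Set ℕ :=
  {t | t ∈ Y ∧ ∀ γ, ∀ _ : γ < β, ∀ n ∈ survivors tg Y γ, ∀ u, tg n = some (u, γ) →
    ¬ (u ≤ t ∧ t < n)}
termination_by β

theorem mem_survivors {Y : Set ℕ} {t : ℕ} : t ∈ survivors tg Y β ↔ t ∈ Y ∧ ∀ γ, γ < β →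
    ∀ n ∈ survivors tg Y γ, ∀ u, tg n = some (u, γ) → ¬ (u ≤ t ∧ t < n) := by
  rw [survivors]
  rfl

theorem survivors_subset {Y : Set ℕ} : survivors tg Y β ⊆ Y := fun _ h => (mem_survivors.1 h).1

theorem survivors_anti {Y : Set ℕ} (h : β ≤ γ) : survivors tg Y γ ⊆ survivors tg Y β :=
  fun _ ht => mem_survivors.2 ⟨survivors_subset ht, fun δ hδ =>
    (mem_survivors.1 ht).2 δ (hδ.trans_le h)⟩

theorem exists_of_not_mem_survivors {Y : Set ℕ} {t : ℕ} (ht : t ∈ Y) (h : t ∉ survivors tg Y β) :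
    ∃ γ < β, ∃ n ∈ survivors tg Y γ, ∃ u, tg n = some (u, γ) ∧ u ≤ t ∧ t < n := by
  rw [mem_survivors] at h
  push Not at h
  obtain ⟨γ, hγ, n, hn, u, h₁, h₂⟩ := h ht
  exact ⟨γ, hγ, n, hn, u, h₁, h₂⟩

theorem survivors_not_between {Y : Set ℕ} {t n u : ℕ} (ht : t ∈ survivors tg Y β)
    (hγ : γ < β) (hn : n ∈ survivors tg Y γ) (h : tg n = some (u, γ)) (hu : u ≤ t) : n ≤ t :=
  not_lt.1 fun h' => (mem_survivors.1 ht).2 γ hγ n hn u h ⟨hu, h'⟩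

/-- An infinite branch of the base parent function. -/
structure Branch (p0 : ℕ → ℕ) (Y : Set ℕ) : Prop where
  infinite : Y.Infinite
  closed : ∀ n ∈ Y, p0 n ∈ Y
  le_parent : ∀ {t n}, t ∈ Y → n ∈ Y → t < n → t ≤ p0 n
  parent_lt : ∀ {t n}, t ∈ Y → n ∈ Y → t < n → p0 n < n

namespace Good

variable {Y : Set ℕ} (G : Good p0 tg α) (hY : Branch p0 Y)
include G hY

theorem target_mem {n u : ℕ} {ε : Ordinal} (h : tg n = some (u, ε)) (hn : n ∈ Y) : u ∈ Y := by
  have := G.anc_mono zero_le le_rfl (G.anc_target h)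
  rw [lvl_zero] at this
  exact this.mem_of_mem hY.closed (hY.closed n hn)

theorem anc_of_survivors
    (h : ∀ t ∈ survivors tg Y β, ∀ n ∈ survivors tg Y β, t < n → t ≤ lvl p0 tg β n)
    (h' : ∀ n ∈ survivors tg Y β, lvl p0 tg β n ∈ survivors tg Y β)
    {t n : ℕ} (ht : t ∈ survivors tg Y β) (hn : n ∈ survivors tg Y β) (htn : t ≤ n) :
    Anc (lvl p0 tg β) t n := by
  induction n using Nat.strong_induction_on with
  | _ n ih =>
    rcases htn.eq_or_lt with rfl | htn
    · exact .refl _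
    · exact .step (ih _ (G.lvl_lt (hY.parent_lt (survivors_subset ht) (survivors_subset hn) htn))
        (h' n hn) (h t ht n hn htn))

theorem survivors_lvl (hβ : β ≤ α) :
    (∀ n ∈ survivors tg Y β, lvl p0 tg β n ∈ survivors tg Y β) ∧
      ∀ t ∈ survivors tg Y β, ∀ n ∈ survivors tg Y β, t < n → t ≤ lvl p0 tg β n := by
  induction β using WellFoundedLT.induction with
  | _ β ih =>
    constructor
    · intro n hn
      have hnY := survivors_subset hn
      rcases label_cases tg β n with ⟨u, γ, h, hγ⟩ | h
      · rw [lvl_of_lt h hγ]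
        have huY := G.target_mem hY h hnY
        by_contra hk
        obtain ⟨δ, hδ, m, hm, w, hmw, h₁, h₂⟩ :=
          exists_of_not_mem_survivors (hY.closed u huY) hk
        have hmY := survivors_subset hm
        have hu := G.parent_target_lt h
        have hun := G.target_le h
        have hnn := G.parent_lt h
        have hmn : m ≤ n := survivors_not_between hn hδ hm hmw (by omega)
        have hne : m ≠ n := by
          rintro rfl
          rw [h] at hmw
          simp only [Option.some.injEq, Prod.mk.injEq] at hmw
          omega
        have hmp : m ≤ p0 n := hY.le_parent hmY hnY (by omega)
        have hum : u ≤ m := not_lt.1 fun h' => by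
          have := hY.le_parent hmY huY h'
          omega
        rcases lt_or_ge γ δ with hγδ | hγδ
        · have := survivors_not_between hm hγδ (survivors_anti hγ.le hn) h hum
          omega
        · have hA := ih δ hδ (hδ.le.trans hβ)
          have hp := hA.1 n (survivors_anti hδ.le hn)
          rw [lvl_of_le' h hγδ] at hp
          have := G.anc_succ_of_le (hδ.trans_le hβ)
            (G.anc_mono (Order.succ_le_of_lt (hδ.trans_le hβ)) le_rfl (G.anc_target h))
            (G.anc_of_survivors hY hA.2 hA.1 hm hp hmp) hum
          rcases this.eq_or with rfl | this
          · exact absurd (G.label_lt h hmw) (not_lt.2 hγδ)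
          · rw [lvl_of_lt hmw (Order.lt_succ δ)] at this
            have h₃ := G.anc_le this
            have h₄ := G.parent_target_lt hmw
            omega
      · rw [lvl_of_le h]
        by_contra hk
        obtain ⟨γ, hγ, m, hm, u, hmu, h₁, h₂⟩ :=
          exists_of_not_mem_survivors (hY.closed n hnY) hk
        have hle := G.le n
        have hmn : m ≤ n := survivors_not_between hn hγ hm hmu (by omega)
        rcases hmn.eq_or_lt with rfl | hmn
        · exact absurd (h _ _ hmu) (not_le.2 hγ)
        · have := hY.le_parent (survivors_subset hm) hnY hmn
          omega
    · intro t ht n hn htn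
      have hnY := survivors_subset hn
      have htY := survivors_subset ht
      rcases label_cases tg β n with ⟨u, γ, h, hγ⟩ | h
      · rw [lvl_of_lt h hγ]
        refine hY.le_parent htY (G.target_mem hY h hnY) (not_le.1 fun h' => ?_)
        have := survivors_not_between ht hγ (survivors_anti hγ.le hn) h h'
        omega
      · rw [lvl_of_le h]
        exact hY.le_parent htY hnY htn

theorem survivors_anc (hβ : β ≤ α) {t n : ℕ} (ht : t ∈ survivors tg Y β)
    (hn : n ∈ survivors tg Y β) (htn : t ≤ n) : Anc (lvl p0 tg β) t n :=
  G.anc_of_survivors hY (G.survivors_lvl hY hβ).2 (G.survivors_lvl hY hβ).1 ht hn htn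

theorem survivors_mem_of_anc (hβ : β ≤ α) {t n : ℕ} (h : Anc (lvl p0 tg β) t n)
    (hn : n ∈ survivors tg Y β) : t ∈ survivors tg Y β :=
  h.mem_of_mem (G.survivors_lvl hY hβ).1 hn

theorem survivors_infinite (hβ : β ≤ α) : (survivors tg Y β).Infinite := by
  classical
  have hne : (survivors tg Y β).Nonempty := by
    obtain ⟨y, hy⟩ := hY.infinite.nonempty
    have hex : ∃ n, n ∈ Y := ⟨y, hy⟩
    refine ⟨Nat.find hex, ?_⟩
    by_contra hk
    obtain ⟨γ, hγ, m, hm, u, hmu, h₁, h₂⟩ := exists_of_not_mem_survivors (Nat.find_spec hex) hk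
    have hu := G.target_mem hY hmu (survivors_subset hm)
    exact Nat.find_min hex ((G.parent_target_lt hmu).trans_le h₁) (hY.closed u hu)
  have hnext : ∀ t ∈ survivors tg Y β, ∃ n ∈ survivors tg Y β, t < n := by
    intro t ht
    have htY := survivors_subset ht
    have hex : ∃ n, n ∈ Y ∧ t < n := by
      obtain ⟨n, hn, h⟩ := hY.infinite.exists_gt t
      exact ⟨n, hn, h⟩
    obtain ⟨c, hc⟩ : ∃ c, c = Nat.find hex := ⟨_, rfl⟩
    obtain ⟨hcY, htc⟩ : c ∈ Y ∧ t < c := hc ▸ Nat.find_spec hex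
    have hmin : ∀ n ∈ Y, t < n → c ≤ n := fun n hn h => hc ▸ Nat.find_min' hex ⟨hn, h⟩
    have hpc : p0 c = t := by
      have h₁ := hY.le_parent htY hcY htc
      have h₂ := hY.parent_lt htY hcY htc
      by_contra hne
      have := hmin _ (hY.closed c hcY) (by omega)
      omega
    by_cases hcB : c ∈ survivors tg Y β
    · exact ⟨c, hcB, htc⟩
    obtain ⟨γ, hγ, n, hn, u, hnu, h₁, h₂⟩ := exists_of_not_mem_survivors hcY hcB
    have htu : t < u := not_le.1 fun h => by
      have := survivors_not_between ht hγ hn hnu h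
      omega
    have hnY := survivors_subset hn
    obtain rfl : u = c := le_antisymm h₁ (hmin u (G.target_mem hY hnu hnY) htu)
    refine ⟨n, ?_, htc.trans h₂⟩
    by_contra hk
    obtain ⟨γ', hγ', n', hn', u', hnu', h₁', h₂'⟩ := exists_of_not_mem_survivors hnY hk
    have hn'Y := survivors_subset hn'
    have htu' : t < u' := not_le.1 fun h => by
      have := survivors_not_between ht hγ' hn' hnu' h
      omega
    have huu' : u ≤ u' := hmin u' (G.target_mem hY hnu' hn'Y) htu'
    rcases lt_trichotomy γ γ' with hlt | rfl | hlt
    · have hp := (G.survivors_lvl hY (hγ'.le.trans hβ)).1 n' hn'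
      rw [lvl_of_le' hnu' le_rfl] at hp
      have hu'B := G.survivors_mem_of_anc hY (hγ'.le.trans hβ)
        (G.anc_mono (hγ'.le.trans hβ) le_rfl (G.anc_target hnu')) hp
      have := survivors_not_between hu'B hlt hn hnu huu'
      obtain rfl : u' = n := by omega
      exact absurd (G.label_lt hnu' hnu) (not_lt.2 hlt.le)
    · have hp := (G.survivors_lvl hY (hγ.le.trans hβ)).1 n' hn'
      rw [lvl_of_le' hnu' le_rfl] at hp
      have hα := hγ.trans_le hβ
      have := G.anc_succ_of_le hα
        (G.anc_mono (Order.succ_le_of_lt hα) le_rfl (G.anc_target hnu'))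
        (G.survivors_anc hY hα.le hn hp (hY.le_parent hnY hn'Y h₂')) h₁'
      rcases this.eq_or with rfl | this
      · exact absurd (G.label_lt hnu' hnu) (lt_irrefl _)
      · rw [lvl_of_lt hnu (Order.lt_succ γ), hpc] at this
        have := G.anc_le this
        omega
    · have := survivors_not_between hn hlt hn' hnu' h₁'
      omega
  refine Set.infinite_of_not_bddAbove ?_
  rintro ⟨M, hM⟩
  have : ∀ k : ℕ, ∃ n ∈ survivors tg Y β, k ≤ n := by
    intro k
    induction k with
    | zero => exact ⟨_, hne.some_mem, Nat.zero_le _⟩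
    | succ k ih =>
      obtain ⟨n, hn, hk⟩ := ih
      obtain ⟨n', hn', h⟩ := hnext n hn
      exact ⟨n', hn', by omega⟩
  obtain ⟨n, hn, h⟩ := this (M + 1)
  have := hM hn
  omega

theorem subset_survivors (hβ : β ≤ α) {Z : Set ℕ} (hZY : Z ⊆ Y) (hZ : Z.Infinite)
    (hanc : ∀ a ∈ Z, ∀ b ∈ Z, a ≤ b → Anc (lvl p0 tg α) a b) : Z ⊆ survivors tg Y β := by
  induction β using WellFoundedLT.induction with
  | _ β ih =>
    intro z hz
    by_contra hk
    obtain ⟨γ, hγ, n, hn, u, hnu, h₁, h₂⟩ := exists_of_not_mem_survivors (hZY hz) hk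
    obtain ⟨z', hz', hnz'⟩ := hZ.exists_gt n
    have hα := hγ.trans_le hβ
    have := G.anc_succ_of_le hα
      (G.anc_mono (Order.succ_le_of_lt hα) le_rfl (hanc z hz z' hz' (by omega)))
      (G.survivors_anc hY hα.le hn (ih γ hγ hα.le hz') hnz'.le) h₂.le
    rcases this.eq_or with rfl | this
    · omega
    · rw [lvl_of_lt hnu (Order.lt_succ γ)] at this
      have h₃ := G.anc_le this
      have h₄ := G.parent_target_lt hnu
      omega

end Good

end Levels

/-- The state with stage `v` and bit `i`. -/
def st (v : ℕ) (i : Bool) : ℕ := 2 * v + i.toNat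

/-- The bit of a state. -/
def bit (s : ℕ) : Bool := decide (s % 2 = 1)

@[simp] theorem st_div (v : ℕ) (i : Bool) : st v i / 2 = v := by
  cases i
  · simp [st]
  · simp [st]
    omega

@[simp] theorem bit_st (v : ℕ) (i : Bool) : bit (st v i) = i := by
  cases i <;> simp [st, bit]

@[simp] theorem st_bit (s : ℕ) : st (s / 2) (bit s) = s := by
  rcases Nat.mod_two_eq_zero_or_one s with h | h <;> simp [st, bit, h] <;> omega

theorem st_lt_st {v w : ℕ} (h : v < w) (i j : Bool) : st v i < st w j := by
  cases i <;> cases j <;> simp [st] <;> omega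

theorem exists_eq_st (s : ℕ) : ∃ v i, s = st v i := ⟨s / 2, bit s, (st_bit s).symm⟩

/-- The kinds of stages. -/
inductive Kind : Type (u + 1)
  | push : Kind
  | split (i : Bool) (l : Ordinal.{u}) : Kind
  | undo (v : ℕ) (c d : Bool) (l : Ordinal.{u}) : Kind

namespace Kind

/-- Whether a stage merges the two branches. -/
def IsSplit : Kind.{u} → Prop
  | split _ _ => True
  | _ => False

/-- All labels of a kind are below `α`. -/
def Below (α : Ordinal.{u}) : Kind.{u} → Prop
  | push => True
  | split _ l => l < α
  | undo _ _ _ l => l < α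

end Kind

open Kind

/-- The top-level parent of a stage. -/
def par (K : ℕ → Kind.{u}) (v : ℕ) : ℕ :=
  match K v with
  | undo u _ _ _ => u - 1
  | _ => v - 1

/-- `Rch K a b`: going from `b` to `a` along top-level parents without crossing a split. -/
inductive Rch (K : ℕ → Kind.{u}) : ℕ → ℕ → Prop
  | refl (a : ℕ) : Rch K a a
  | step {a b : ℕ} : par K b < b → ¬ (K b).IsSplit → Rch K a (par K b) → Rch K a b

/-- The state of stage `v` and bit `j` has base parent of bit `i`, with label `l`. -/
def Lab (K : ℕ → Kind.{u}) (v : ℕ) (j i : Bool) (l : Ordinal.{u}) : Prop :=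
  K v = split i l ∨ ∃ u, K v = undo u j i l

/-- Whether a kind is allowed at stage `n + 1`. -/
def Legal (K : ℕ → Kind.{u}) (n : ℕ) : Kind.{u} → Prop
  | push => True
  | split _ _ => Rch K 0 n
  | undo u c d ε => 1 ≤ u ∧ u ≤ n ∧ Rch K u n ∧ ∃ l, Lab K u d c l ∧ ε < l

/-- Sequences of kinds all of which are allowed. -/
structure Valid (α : Ordinal.{u}) (K : ℕ → Kind.{u}) : Prop where
  zero : K 0 = push
  below : ∀ n, (K n).Below α
  legal : ∀ n, Legal K n (K (n + 1))

/-- The base parent function on states. -/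
def stPar (K : ℕ → Kind.{u}) (s : ℕ) : ℕ :=
  match K (s / 2) with
  | push => st (s / 2 - 1) (bit s)
  | split i _ => st (s / 2 - 1) i
  | undo u c d _ => if bit s = c then st (s / 2 - 1) d else st (u - 1) (bit s)

/-- Targets and labels of stages. -/
def tgStage (K : ℕ → Kind.{u}) (v : ℕ) : Option (ℕ × Ordinal.{u}) :=
  match K v with
  | undo u _ _ ε => some (u, ε)
  | _ => none

/-- Targets and labels of states. -/
def tgState (K : ℕ → Kind.{u}) (s : ℕ) : Option (ℕ × Ordinal.{u}) :=
  match K (s / 2) with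
  | undo u c d ε => if bit s = c then some (st u d, ε) else none
  | _ => none

/-- The branches through the states. -/
def IsBranch (K : ℕ → Kind.{u}) (y : ℕ → ℕ) : Prop :=
  y 0 < 2 ∧ ∀ k, y k / 2 < y (k + 1) / 2 ∧ stPar K (y (k + 1)) = y k

section Combinatorics

variable {α : Ordinal.{u}} {K : ℕ → Kind.{u}}

theorem Rch.trans {a b c : ℕ} (h₁ : Rch K a b) (h₂ : Rch K b c) : Rch K a c := by
  induction h₂ with
  | refl => exact h₁
  | step h h' _ ih => exact .step h h' ih

theorem Rch.anc {a b : ℕ} (h : Rch K a b) : Anc (par K) a b := by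
  induction h with
  | refl => exact .refl _
  | step _ _ _ ih => exact .step ih

theorem tgStage_eq_some {v u : ℕ} {ε : Ordinal.{u}} :
    tgStage K v = some (u, ε) ↔ ∃ c d, K v = undo u c d ε := by
  unfold tgStage
  split <;> simp_all

theorem tgState_eq_some {v t : ℕ} {i : Bool} {ε : Ordinal.{u}} :
    tgState K (st v i) = some (t, ε) ↔ ∃ u d, K v = undo u i d ε ∧ t = st u d := by
  unfold tgState
  rw [st_div, bit_st]
  split
  · rename_i u c d ε' h
    constructor
    · intro h'
      split_ifs at h' with hi
      simp only [Option.some.injEq, Prod.mk.injEq] at h'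
      exact ⟨u, d, by rw [h, hi, h'.2], h'.1.symm⟩
    · rintro ⟨u', d', h', rfl⟩
      rw [h] at h'
      simp only [undo.injEq] at h'
      obtain ⟨rfl, rfl, rfl, rfl⟩ := h'
      simp
  · rename_i h
    simp only [reduceCtorEq, false_iff, not_exists, not_and]
    intro u d h'
    exact absurd h' (h _ _ _ _)

theorem stPar_of_lab {v : ℕ} {j i : Bool} {l : Ordinal.{u}} (h : Lab K v j i l) :
    stPar K (st v j) = st (v - 1) i := by
  rcases h with h | ⟨u, h⟩ <;> simp [stPar, h]

namespace Valid

variable (V : Valid α K)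
include V

theorem pos_of_undo {v u : ℕ} {c d : Bool} {ε : Ordinal.{u}} (h : K v = undo u c d ε) : 0 < v := by
  rcases Nat.eq_zero_or_pos v with rfl | h'
  · simp [V.zero] at h
  · exact h'

theorem legal_undo {v u : ℕ} {c d : Bool} {ε : Ordinal.{u}} (h : K v = undo u c d ε) :
    1 ≤ u ∧ u ≤ v - 1 ∧ Rch K u (v - 1) ∧ ∃ l, Lab K u d c l ∧ ε < l := by
  have h' := V.legal (v - 1)
  rw [Nat.sub_add_cancel (V.pos_of_undo h), h] at h'
  exact h'

theorem par_lt {v : ℕ} (hv : 0 < v) : par K v < v := by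
  unfold par
  split
  · rename_i h
    have := V.legal_undo h
    omega
  · omega

theorem par_le (v : ℕ) : par K v ≤ v := by
  rcases Nat.eq_zero_or_pos v with rfl | h
  · simp [par, V.zero]
  · exact (V.par_lt h).le

theorem lvl_stage (v : ℕ) : lvl (fun v => v - 1) (tgStage K) α v = par K v := by
  rcases label_cases (tgStage K) α v with ⟨u, ε, h, hε⟩ | h
  · rw [lvl_of_lt h hε]
    obtain ⟨c, d, h⟩ := tgStage_eq_some.1 h
    simp [par, h]
  · rw [lvl_of_le h]
    have hb := V.below v
    unfold par
    split
    · rename_i u c d ε h'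
      rw [h'] at hb
      exact absurd (h _ _ (tgStage_eq_some.2 ⟨_, _, h'⟩)) (not_le.2 hb)
    · rfl

theorem lvl_stage_eq : lvl (fun v => v - 1) (tgStage K) α = par K := funext V.lvl_stage

theorem good_stage : Good (fun v => v - 1) (tgStage K) α where
  le n := Nat.sub_le _ _
  lt_bound h := by
    rename_i n u ε
    obtain ⟨c, d, h⟩ := tgStage_eq_some.1 h
    have := V.below n
    rwa [h] at this
  parent_lt h := by
    obtain ⟨c, d, h⟩ := tgStage_eq_some.1 h
    have := V.pos_of_undo h
    change _ - 1 < _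
    omega
  parent_target_lt h := by
    obtain ⟨c, d, h⟩ := tgStage_eq_some.1 h
    have := V.legal_undo h
    change _ - 1 < _
    omega
  anc_target h := by
    obtain ⟨c, d, h⟩ := tgStage_eq_some.1 h
    rw [V.lvl_stage_eq]
    exact (V.legal_undo h).2.2.1.anc
  label_lt h h' := by
    obtain ⟨c, d, h⟩ := tgStage_eq_some.1 h
    obtain ⟨c', d', h'⟩ := tgStage_eq_some.1 h'
    obtain ⟨_, _, _, l, hl | ⟨w, hl⟩, hlt⟩ := V.legal_undo h
    · simp [h'] at hl
    · rw [h'] at hl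
      simp only [undo.injEq] at hl
      exact hl.2.2.2 ▸ hlt

theorem stPar_lt {v : ℕ} (hv : 0 < v) (i : Bool) : stPar K (st v i) < st v i ∧
    stPar K (st v i) / 2 < v := by
  unfold stPar
  rw [st_div, bit_st]
  split
  · simpa using ⟨st_lt_st (by omega) _ _, hv⟩
  · simpa using ⟨st_lt_st (by omega) _ _, hv⟩
  · rename_i u c d ε h
    have := V.legal_undo h
    split_ifs <;> rw [st_div] <;> exact ⟨st_lt_st (by omega) _ _, by omega⟩

theorem stPar_zero (i : Bool) : stPar K (st 0 i) = st 0 i := by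
  simp [stPar, V.zero]

theorem stPar_le (s : ℕ) : stPar K s ≤ s := by
  obtain ⟨v, i, rfl⟩ := exists_eq_st s
  rcases Nat.eq_zero_or_pos v with rfl | h
  · exact (V.stPar_zero i).le
  · exact (V.stPar_lt h i).1.le

theorem lvl_state {v : ℕ} (h : ¬ (K v).IsSplit) (i : Bool) :
    lvl (stPar K) (tgState K) α (st v i) = st (par K v) i := by
  rcases label_cases (tgState K) α (st v i) with ⟨t, ε, h', hε⟩ | h'
  · rw [lvl_of_lt h' hε]
    obtain ⟨u, d, hK, rfl⟩ := tgState_eq_some.1 h'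
    obtain ⟨_, _, _, l, hl, _⟩ := V.legal_undo hK
    rw [stPar_of_lab hl]
    simp [par, hK]
  · rw [lvl_of_le h']
    have hb := V.below v
    unfold stPar par
    rw [st_div, bit_st]
    split
    · rename_i hK
      simp [hK]
    · rename_i hK
      simp [hK, IsSplit] at h
    · rename_i u c d ε hK
      rw [hK]
      rw [hK] at hb
      split_ifs with hi
      · subst hi
        exact absurd (h' _ _ (tgState_eq_some.2 ⟨_, _, hK, rfl⟩)) (not_le.2 hb)
      · rfl

theorem lvl_state_div (s : ℕ) : lvl (stPar K) (tgState K) α s / 2 = par K (s / 2) := by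
  obtain ⟨v, i, rfl⟩ := exists_eq_st s
  by_cases h : (K v).IsSplit
  · have : tgState K (st v i) = none := by
      unfold tgState
      rw [st_div]
      split
      · rename_i h'
        simp [h', IsSplit] at h
      · rfl
    rw [lvl_of_le (by simp [this])]
    unfold stPar par
    rw [st_div]
    cases h' : K v with
    | split => simp
    | push => simp [h', IsSplit] at h
    | undo => simp [h', IsSplit] at h
  · rw [V.lvl_state h]
    simp

theorem _root_.Rch.anc_state {a b : ℕ} (h : Rch K a b) (i : Bool) :
    Anc (lvl (stPar K) (tgState K) α) (st a i) (st b i) := by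
  induction h with
  | refl => exact .refl _
  | step _ h _ ih =>
    refine .step ?_
    rwa [V.lvl_state h]

theorem anc_div {s t : ℕ} (h : Anc (lvl (stPar K) (tgState K) α) s t) :
    Anc (par K) (s / 2) (t / 2) := by
  induction h with
  | refl => exact .refl _
  | step _ ih =>
    refine .step ?_
    rwa [V.lvl_state_div] at ih

theorem good_state : Good (stPar K) (tgState K) α where
  le := V.stPar_le
  lt_bound {n u ε} h := by
    obtain ⟨v, i, rfl⟩ := exists_eq_st n
    obtain ⟨w, d, hK, rfl⟩ := tgState_eq_some.1 h
    have := V.below v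
    rwa [hK] at this
  parent_lt {n u ε} h := by
    obtain ⟨v, i, rfl⟩ := exists_eq_st n
    obtain ⟨w, d, hK, rfl⟩ := tgState_eq_some.1 h
    exact (V.stPar_lt (V.pos_of_undo hK) i).1
  parent_target_lt {n u ε} h := by
    obtain ⟨v, i, rfl⟩ := exists_eq_st n
    obtain ⟨w, d, hK, rfl⟩ := tgState_eq_some.1 h
    exact (V.stPar_lt (V.legal_undo hK).1 d).1
  anc_target {n u ε} h := by
    obtain ⟨v, i, rfl⟩ := exists_eq_st n
    obtain ⟨w, d, hK, rfl⟩ := tgState_eq_some.1 h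
    have : stPar K (st v i) = st (v - 1) d := by simp [stPar, hK]
    rw [this]
    exact (V.legal_undo hK).2.2.1.anc_state V d
  label_lt {n u ε u' ε'} h h' := by
    obtain ⟨v, i, rfl⟩ := exists_eq_st n
    obtain ⟨w, d, hK, rfl⟩ := tgState_eq_some.1 h
    obtain ⟨w', d', hK', rfl⟩ := tgState_eq_some.1 h'
    obtain ⟨_, _, _, l, hl | ⟨w, hl⟩, hlt⟩ := V.legal_undo hK
    · simp [hK'] at hl
    · rw [hK'] at hl
      simp only [undo.injEq] at hl
      exact hl.2.2.2 ▸ hlt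

theorem anc_stPar {a b : ℕ} (h : Rch K a b) (i : Bool) :
    Anc (stPar K) (st a i) (st b i) := by
  have := V.good_state.anc_mono zero_le le_rfl (h.anc_state V i)
  rwa [lvl_zero] at this

end Valid

theorem Anc.anc_of_le {p : ℕ → ℕ} (hp : ∀ m, p m ≤ m) {a b c : ℕ} (h₁ : Anc p a c)
    (h₂ : Anc p b c) (hab : a ≤ b) : Anc p a b := by
  induction h₂ with
  | refl => exact h₁
  | step h₂ ih =>
    rename_i c
    rcases h₁.eq_or with rfl | h₁
    · have := h₂.le hp
      obtain rfl : a = b := le_antisymm hab (this.trans (hp a))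
      exact .refl _
    · exact ih h₁

namespace IsBranch

variable {y z : ℕ → ℕ}

theorem div_strictMono (hy : IsBranch K y) : StrictMono fun k => y k / 2 :=
  strictMono_nat_of_lt_succ fun k => (hy.2 k).1

theorem strictMono (hy : IsBranch K y) : StrictMono y :=
  strictMono_nat_of_lt_succ fun k => by
    have := (hy.2 k).1
    omega

theorem eq_of_div_eq (hy : IsBranch K y) {s t : ℕ} (hs : s ∈ Set.range y) (ht : t ∈ Set.range y)
    (h : s / 2 = t / 2) : s = t := by
  obtain ⟨a, rfl⟩ := hs
  obtain ⟨b, rfl⟩ := ht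
  rw [hy.div_strictMono.injective h]

theorem branch (V : Valid α K) (hy : IsBranch K y) : Branch (stPar K) (Set.range y) where
  infinite := Set.infinite_range_of_injective hy.strictMono.injective
  closed := by
    rintro _ ⟨_ | k, rfl⟩
    · obtain ⟨v, i, h⟩ := exists_eq_st (y 0)
      have : v = 0 := by
        rw [← st_div v i, ← h]
        have := hy.1
        omega
      rw [h, this, V.stPar_zero, ← this, ← h]
      exact ⟨0, rfl⟩
    · rw [(hy.2 k).2]
      exact ⟨k, rfl⟩
  le_parent := by
    rintro _ _ ⟨a, rfl⟩ ⟨b, rfl⟩ h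
    obtain ⟨b, rfl⟩ : ∃ b', b = b' + 1 := ⟨b - 1, by have := hy.strictMono.lt_iff_lt.1 h; omega⟩
    rw [(hy.2 b).2]
    exact hy.strictMono.monotone (Nat.lt_succ_iff.1 (hy.strictMono.lt_iff_lt.1 h))
  parent_lt := by
    rintro _ _ ⟨a, rfl⟩ ⟨b, rfl⟩ h
    obtain ⟨b, rfl⟩ : ∃ b', b = b' + 1 := ⟨b - 1, by have := hy.strictMono.lt_iff_lt.1 h; omega⟩
    rw [(hy.2 b).2]
    exact hy.strictMono (Nat.lt_succ_self b)

theorem anc (hy : IsBranch K y) {s t : ℕ} (hs : s ∈ Set.range y)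
    (ht : t ∈ Set.range y) (h : s ≤ t) : Anc (stPar K) s t := by
  obtain ⟨a, rfl⟩ := hs
  obtain ⟨b, rfl⟩ := ht
  have hab := hy.strictMono.le_iff_le.1 h
  clear h
  induction b, hab using Nat.le_induction with
  | base => exact .refl _
  | succ b _ ih =>
    refine .step ?_
    rwa [(hy.2 b).2]

theorem ext_range (hy : IsBranch K y) (hz : IsBranch K z) (h : Set.range y = Set.range z) :
    y = z :=
  (hy.strictMono.range_inj hz.strictMono).1 h

/-- Branches through a common state agree below it. -/
theorem eq_below {K' : ℕ → Kind.{u}} (hy : IsBranch K y) (hz : IsBranch K' z) {a b : ℕ}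
    (h : y a = z b) (hK : ∀ v ≤ y a / 2, K v = K' v) : ∀ k ≤ a, y k = z k := by
  induction a generalizing b with
  | zero =>
    obtain rfl : b = 0 := by
      rcases b with _ | b
      · rfl
      · have := (hz.2 b).1
        have := hy.1
        omega
    intro k hk
    obtain rfl : k = 0 := by omega
    exact h
  | succ a ih =>
    rcases b with _ | b
    · have := (hy.2 a).1
      have := hz.1
      omega
    have hab : y a = z b := by
      rw [← (hy.2 a).2, ← (hz.2 b).2, ← h]
      unfold stPar
      rw [hK _ le_rfl]
    have hba : b = a := by
      have := ih hab fun v hv => hK v (hv.trans (hy.2 a).1.le)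
      exact hz.strictMono.injective (hab.symm.trans (this a le_rfl))
    intro k hk
    rcases hk.eq_or_lt with rfl | hk
    · rw [h, hba]
    · exact ih hab (fun v hv => hK v (hv.trans (hy.2 a).1.le)) k (by omega)

end IsBranch

theorem Valid.exists_isBranch (V : Valid α K) {T : Set ℕ} (hT : T.Infinite)
    (hanc : ∀ s ∈ T, ∀ t ∈ T, s ≤ t → Anc (stPar K) s t) :
    ∃ y, IsBranch K y ∧ Set.range y = {t | ∃ s ∈ T, Anc (stPar K) t s} := by
  classical
  set Y : Set ℕ := {t | ∃ s ∈ T, Anc (stPar K) t s} with hY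
  have hTY : T ⊆ Y := fun t ht => ⟨t, ht, .refl _⟩
  have hYinf : Y.Infinite := hT.mono hTY
  have hcl : ∀ t ∈ Y, stPar K t ∈ Y := fun t ⟨s, hs, h⟩ => ⟨s, hs, (Anc.parent t).trans h⟩
  have hlin : ∀ t ∈ Y, ∀ n ∈ Y, t ≤ n → Anc (stPar K) t n := by
    rintro t ⟨s, hs, h⟩ n ⟨s', hs', h'⟩ htn
    rcases le_total s s' with hss | hss
    · exact (h.trans (hanc s hs s' hs' hss)).anc_of_le V.stPar_le h' htn
    · exact h.anc_of_le V.stPar_le (h'.trans (hanc s' hs' s hs hss)) htn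
  have hmem : ∀ k, Nat.nth (· ∈ Y) k ∈ Y := fun k => Nat.nth_mem_of_infinite hYinf k
  have hmono := Nat.nth_strictMono (p := (· ∈ Y)) hYinf
  have hrange : Set.range (Nat.nth (· ∈ Y)) = Y := Nat.range_nth_of_infinite hYinf
  have hpar : ∀ k, stPar K (Nat.nth (· ∈ Y) (k + 1)) = Nat.nth (· ∈ Y) k := by
    intro k
    have hlt := hmono (Nat.lt_succ_self k)
    have h₁ := (hlin _ (hmem k) _ (hmem (k + 1)) hlt.le).eq_or.resolve_left hlt.ne
    have h₂ := h₁.le V.stPar_le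
    have h₃ := hcl _ (hmem (k + 1))
    have h₄ : stPar K (Nat.nth (· ∈ Y) (k + 1)) < Nat.nth (· ∈ Y) (k + 1) := by
      generalize Nat.nth (· ∈ Y) (k + 1) = n at *
      obtain ⟨v, i, rfl⟩ := exists_eq_st n
      rcases Nat.eq_zero_or_pos v with rfl | hv
      · rw [V.stPar_zero] at h₁
        have key : ∀ {m}, Anc (stPar K) (Nat.nth (· ∈ Y) k) m → m = st 0 i →
            Nat.nth (· ∈ Y) k = st 0 i := by
          intro m hm
          induction hm with
          | refl => exact id
          | step _ ih =>
            rintro rfl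
            exact ih (V.stPar_zero i)
        exact absurd (key h₁ rfl) hlt.ne
      · exact (V.stPar_lt hv i).1
    obtain ⟨j, hj⟩ := hrange.ge h₃
    rw [← hj] at h₂ h₄ ⊢
    have := hmono.le_iff_le.1 h₂
    have := hmono.lt_iff_lt.1 h₄
    rw [show j = k by omega]
  refine ⟨Nat.nth (· ∈ Y), ⟨?_, fun k => ⟨?_, hpar k⟩⟩, hrange⟩
  · by_contra hge
    have h₃ := hcl _ (hmem 0)
    obtain ⟨v, i, h⟩ := exists_eq_st (Nat.nth (· ∈ Y) 0)
    have hv : 0 < v := by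
      rw [← st_div v i, ← h]
      omega
    have h₄ := (V.stPar_lt hv i).1
    rw [← h] at h₄
    obtain ⟨j, hj⟩ := hrange.ge h₃
    rw [← hj] at h₄
    have := hmono.lt_iff_lt.1 h₄
    omega
  · obtain ⟨v, i, h⟩ := exists_eq_st (Nat.nth (· ∈ Y) (k + 1))
    have hp := hpar k
    rw [h] at hp ⊢
    rcases Nat.eq_zero_or_pos v with rfl | hv
    · rw [V.stPar_zero, ← h] at hp
      exact absurd (hmono.injective hp) (by omega)
    · rw [← hp, st_div]
      exact (V.stPar_lt hv i).2

theorem Rch.not_isSplit {n a : ℕ} (V : Valid α K) (h : Rch K 0 n) (ha : 0 < a)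
    (h' : Anc (par K) a n) : ¬ (K a).IsSplit := by
  induction h with
  | refl =>
    have := h'.le V.par_le
    omega
  | step _ hs _ ih =>
    rcases h'.eq_or with rfl | h'
    · exact hs
    · exact ih h'

theorem Valid.branch_stage : Branch (fun v => v - 1) Set.univ where
  infinite := Set.infinite_univ
  closed _ _ := trivial
  le_parent _ _ h := by
    omega
  parent_lt _ _ h := by
    omega

/-- There is an infinite set of stages, eventually unique among infinite top-level branches, which
is linearly ordered by reachability. -/
theorem Valid.exists_stages (V : Valid α K) : ∃ B : Set ℕ, ∃ m ∈ B, B.Infinite ∧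
    (∀ a ∈ B, ∀ b ∈ B, m ≤ a → a ≤ b → Rch K a b) ∧
    ∀ Z : Set ℕ, Z.Infinite → (∀ a ∈ Z, ∀ b ∈ Z, a ≤ b → Anc (par K) a b) → Z ⊆ B := by
  have G := V.good_stage
  have hinf := G.survivors_infinite Valid.branch_stage le_rfl
  have hanc : ∀ a ∈ survivors (tgStage K) Set.univ α, ∀ b ∈ survivors (tgStage K) Set.univ α,
      a ≤ b → Anc (par K) a b := fun a ha b hb hab => by
    have := G.survivors_anc Valid.branch_stage le_rfl ha hb hab
    rwa [V.lvl_stage_eq] at this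
  have hpar : ∀ b ∈ survivors (tgStage K) Set.univ α,
      par K b ∈ survivors (tgStage K) Set.univ α := fun b hb => by
    have := (G.survivors_lvl Valid.branch_stage le_rfl).1 b hb
    rwa [V.lvl_stage_eq] at this
  have hsub := fun Z : Set ℕ => G.subset_survivors Valid.branch_stage le_rfl (Set.subset_univ Z)
  rw [V.lvl_stage_eq] at hsub
  generalize survivors (tgStage K) Set.univ α = B at *
  have hsplit : ∀ a ∈ B, ∀ b ∈ B, a < b → (K a).IsSplit → ¬ (K b).IsSplit := by
    intro a ha b hb hab hsa hsb
    have h₁ := (hanc a ha b hb hab.le).eq_or.resolve_left hab.ne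
    have h₂ := V.legal (b - 1)
    rw [Nat.sub_add_cancel (by omega)] at h₂
    unfold par at h₁
    cases hK : K b with
    | push => simp [hK, IsSplit] at hsb
    | undo => simp [hK, IsSplit] at hsb
    | split i l =>
      rw [hK] at h₁ h₂
      have ha0 : 0 < a := by
        rcases Nat.eq_zero_or_pos a with rfl | h
        · simp [V.zero, IsSplit] at hsa
        · exact h
      exact Rch.not_isSplit V h₂ ha0 h₁ hsa
  obtain ⟨m, hm, hns⟩ : ∃ m ∈ B, ∀ b ∈ B, m < b → ¬ (K b).IsSplit := by
    by_cases h : ∃ a ∈ B, (K a).IsSplit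
    · obtain ⟨a, ha, hsa⟩ := h
      exact ⟨a, ha, fun b hb hab => hsplit a ha b hb hab hsa⟩
    · push Not at h
      obtain ⟨m, hm⟩ := hinf.nonempty
      exact ⟨m, hm, fun b hb _ => h b hb⟩
  refine ⟨B, m, hm, hinf, fun a ha b hb hma hab => ?_, hsub⟩
  have := hanc a ha b hb hab
  clear hab
  induction this with
  | refl => exact .refl _
  | step h ih =>
    rename_i b
    rcases Nat.eq_zero_or_pos b with rfl | hb0
    · have := (Anc.step h).le V.par_le
      obtain rfl : a = 0 := by omega
      exact .refl _
    · have h₁ := h.le V.par_le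
      have h₂ := V.par_lt hb0
      exact .step h₂ (hns b hb (by omega)) (ih (hpar b hb))

/-- There are exactly two branches. -/
theorem Valid.exists_pair (V : Valid α K) : ∃ y z : ℕ → ℕ, y ≠ z ∧ {w | IsBranch K w} = {y, z} := by
  obtain ⟨B, m, hm, hinf, hR, huniq⟩ := V.exists_stages
  have hTinf : ∀ i : Bool, ((fun b => st b i) '' {b | b ∈ B ∧ m ≤ b}).Infinite := by
    intro i
    refine Set.Infinite.image (fun a _ b _ h => ?_) ?_
    · have := congrArg (· / 2) h
      simpa using this
    · intro hfin
      refine hinf ((hfin.union (Set.finite_lt_nat m)).subset fun b hb => ?_)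
      rcases le_or_gt m b with h | h
      · exact .inl ⟨hb, h⟩
      · exact .inr h
  have hex : ∀ i : Bool, ∃ y, IsBranch K y ∧ Set.range y =
      {t | ∃ b ∈ B, m ≤ b ∧ Anc (stPar K) t (st b i)} := by
    intro i
    obtain ⟨y, hy, h⟩ := V.exists_isBranch (hTinf i) (by
      rintro _ ⟨a, ⟨ha, hma⟩, rfl⟩ _ ⟨b, ⟨hb, hmb⟩, rfl⟩ hab
      refine V.anc_stPar (hR a ha b hb hma (not_lt.1 fun h => ?_)) i
      exact absurd hab (not_le.2 (st_lt_st h i i)))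
    refine ⟨y, hy, h.trans ?_⟩
    ext t
    constructor
    · rintro ⟨_, ⟨b, ⟨hb, hmb⟩, rfl⟩, h⟩
      exact ⟨b, hb, hmb, h⟩
    · rintro ⟨b, hb, hmb, h⟩
      exact ⟨_, ⟨b, ⟨hb, hmb⟩, rfl⟩, h⟩
  choose y hy hyr using hex
  have hmem : ∀ i, st m i ∈ Set.range (y i) := fun i => by
    rw [hyr]
    exact ⟨m, hm, le_rfl, .refl _⟩
  refine ⟨y false, y true, fun h => ?_, ?_⟩
  · have h₁ := hmem true
    rw [← h] at h₁
    have := congrArg bit ((hy false).eq_of_div_eq (hmem false) h₁ (by simp))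
    simp at this
  suffices h : ∀ z, IsBranch K z → ∃ i, z = y i by
    ext z
    simp only [Set.mem_ofPred_eq, Set.mem_insert_iff, Set.mem_singleton_iff]
    constructor
    · intro hz
      obtain ⟨_ | _, h⟩ := h z hz
      · exact .inl h
      · exact .inr h
    · rintro (rfl | rfl) <;> exact hy _
  intro z hz
  have G := V.good_state
  have hbr := hz.branch V
  have hCinf := G.survivors_infinite hbr le_rfl
  have hCsub : survivors (tgState K) (Set.range z) α ⊆ Set.range z := survivors_subset
  have hCanc : ∀ s ∈ survivors (tgState K) (Set.range z) α,
      ∀ t ∈ survivors (tgState K) (Set.range z) α, s ≤ t →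
      Anc (lvl (stPar K) (tgState K) α) s t :=
    fun s hs t ht hst => G.survivors_anc hbr le_rfl hs ht hst
  have hCmem : ∀ s, ∀ t ∈ survivors (tgState K) (Set.range z) α,
      Anc (lvl (stPar K) (tgState K) α) s t → s ∈ survivors (tgState K) (Set.range z) α :=
    fun s t ht h => G.survivors_mem_of_anc hbr le_rfl h ht
  generalize survivors (tgState K) (Set.range z) α = C at *
  have hdiv : ∀ s ∈ C, s / 2 ∈ B := by
    have := huniq ((· / 2) '' C) (hCinf.image fun s hs t ht h =>
      hz.eq_of_div_eq (hCsub hs) (hCsub ht) h) (by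
        rintro _ ⟨s, hs, rfl⟩ _ ⟨t, ht, rfl⟩ h
        refine V.anc_div ?_
        rcases le_total s t with hst | hst
        · exact hCanc s hs t ht hst
        · have : s / 2 = t / 2 := le_antisymm h (Nat.div_le_div_right hst)
          rw [hz.eq_of_div_eq (hCsub hs) (hCsub ht) this]
          exact .refl _)
    exact fun s hs => this ⟨s, hs, rfl⟩
  obtain ⟨s₀, hs₀, hms₀⟩ := hCinf.exists_gt (2 * m)
  have hbit : ∀ s ∈ C, s₀ ≤ s → s = st (s / 2) (bit s₀) := by
    intro s hs h
    have hr := hR _ (hdiv _ hs₀) _ (hdiv _ hs) (by omega) (Nat.div_le_div_right h)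
    have h₁ := hr.anc_state V (bit s)
    rw [st_bit s] at h₁
    have h₂ := hz.eq_of_div_eq (hCsub (hCmem _ _ hs h₁)) (hCsub hs₀) (by simp)
    have h₃ := congrArg bit h₂
    rw [bit_st] at h₃
    rw [← h₃, st_bit]
  refine ⟨bit s₀, hz.ext_range (hy _) ?_⟩
  rw [hyr]
  ext t
  constructor
  · intro ht
    obtain ⟨s, hs, hlt⟩ := hCinf.exists_gt (t + s₀)
    refine ⟨s / 2, hdiv s hs, by omega, ?_⟩
    rw [← hbit s hs (by omega)]
    exact hz.anc ht (hCsub hs) (by omega)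
  · rintro ⟨b, hb, hmb, h⟩
    obtain ⟨s, hs, hlt⟩ := hCinf.exists_gt (2 * b + s₀)
    have hr := hR b hb _ (hdiv s hs) hmb (by omega)
    have h₁ := h.trans (V.anc_stPar hr (bit s₀))
    rw [← hbit s hs (by omega)] at h₁
    exact h₁.mem_of_mem hbr.closed (hCsub hs)

end Combinatorics

section Codings

variable {α : Ordinal.{u}}

theorem Rch.congr {K K' : ℕ → Kind.{u}} {a b : ℕ} (h : Rch K a b) (hK : ∀ v ≤ b, K v = K' v) :
    Rch K' a b := by
  induction h with
  | refl => exact .refl _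
  | step hb hs _ ih =>
    rename_i b _
    have hp : par K b = par K' b := by
      unfold par
      rw [hK b le_rfl]
    rw [hp] at hb ih
    rw [hK b le_rfl] at hs
    exact .step hb hs (ih fun v hv => hK v (hv.trans hb.le))

theorem Lab.congr {K K' : ℕ → Kind.{u}} {v : ℕ} {i j : Bool} {l : Ordinal.{u}}
    (h : Lab K v i j l) (hK : K v = K' v) : Lab K' v i j l := by
  unfold Lab at *
  rwa [← hK]

theorem Legal.congr {K K' : ℕ → Kind.{u}} {n : ℕ} {k : Kind.{u}} (h : Legal K n k)
    (hK : ∀ v ≤ n, K v = K' v) : Legal K' n k := by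
  cases k with
  | push => trivial
  | split i l => exact Rch.congr h hK
  | undo v c d ε =>
    obtain ⟨h₁, h₂, h₃, l, hl, hε⟩ := h
    exact ⟨h₁, h₂, h₃.congr hK, l, hl.congr (hK v h₂), hε⟩

variable (α) in
/-- A coding by natural numbers of the kinds with labels below `α`. -/
structure Coding where
  /-- The kind coded by a number. -/
  dec : ℕ → Kind.{u}
  below : ∀ n, (dec n).Below α
  exists_code : ∀ {k : Kind.{u}}, k.Below α → ∃ n, dec n = k

namespace Coding

theorem nonempty (hα : α < (Cardinal.aleph 1).ord) : Nonempty (Coding α) := by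
  have hc : (Set.Iio α).Countable := by
    rw [← Cardinal.le_aleph0_iff_set_countable, Cardinal.mk_Iio_ordinal,
      Cardinal.lift_le_aleph0, ← Cardinal.lt_aleph_one_iff]
    exact Cardinal.lt_ord.1 hα
  have hcount : {k : Kind.{u} | k.Below α}.Countable := by
    have h₁ := ((Set.countable_univ (α := Bool)).prod hc).image fun x => split x.1 x.2
    have h₂ := ((Set.countable_univ (α := ℕ × Bool × Bool)).prod hc).image
      fun x => undo x.1.1 x.1.2.1 x.1.2.2 x.2
    refine (((Set.countable_singleton push).union h₁).union h₂).mono ?_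
    rintro (_ | ⟨i, l⟩ | ⟨v, c, d, l⟩) hk
    · exact .inl (.inl rfl)
    · exact .inl (.inr ⟨(i, l), ⟨trivial, hk⟩, rfl⟩)
    · exact .inr ⟨((v, c, d), l), ⟨trivial, hk⟩, rfl⟩
  obtain ⟨f, hf⟩ := hcount.exists_eq_range ⟨push, trivial⟩
  refine ⟨⟨f, fun n => ?_, fun {k} hk => ?_⟩⟩
  · have : f n ∈ {k : Kind.{u} | k.Below α} := hf ▸ ⟨n, rfl⟩
    exact this
  · have : k ∈ Set.range f := hf ▸ hk
    exact this

variable (D : Coding α)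

/-- A code of the kind `push`. -/
noncomputable def pushCode : ℕ := (D.exists_code (k := push) trivial).choose

@[simp] theorem dec_pushCode : D.dec D.pushCode = push :=
  (D.exists_code (k := push) trivial).choose_spec

/-- The first `n` stages after the root coded by a sequence, followed by pushes. -/
noncomputable def partialKinds (x : ℕ → ℕ) : ℕ → ℕ → Kind.{u}
  | 0 => fun _ => push
  | n + 1 =>
    open Classical in
    Function.update (partialKinds x n) (n + 1)
      (if Legal (partialKinds x n) n (D.dec (x n)) then D.dec (x n) else push)

/-- The sequence of kinds coded by a sequence of numbers; illegal kinds are replaced by pushes. -/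
noncomputable def kinds (x : ℕ → ℕ) (v : ℕ) : Kind.{u} := D.partialKinds x v v

theorem partialKinds_eq (x : ℕ → ℕ) {n v : ℕ} (h : v ≤ n) : D.partialKinds x n v = D.kinds x v := by
  induction n, h using Nat.le_induction with
  | base => rfl
  | succ n h ih =>
    rw [partialKinds, Function.update_of_ne (by omega), ih]

theorem kinds_succ (x : ℕ → ℕ) (n : ℕ) [Decidable (Legal (D.kinds x) n (D.dec (x n)))] :
    D.kinds x (n + 1) = if Legal (D.kinds x) n (D.dec (x n)) then D.dec (x n) else push := by
  have : Legal (D.partialKinds x n) n (D.dec (x n)) ↔ Legal (D.kinds x) n (D.dec (x n)) :=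
    ⟨fun h => h.congr fun v hv => D.partialKinds_eq x hv,
      fun h => h.congr fun v hv => (D.partialKinds_eq x hv).symm⟩
  rw [kinds, partialKinds, Function.update_self]
  simp only [this]

theorem kinds_succ_of_legal {x : ℕ → ℕ} {n : ℕ} (h : Legal (D.kinds x) n (D.dec (x n))) :
    D.kinds x (n + 1) = D.dec (x n) := by
  classical
  rw [kinds_succ, if_pos h]

theorem valid_kinds (x : ℕ → ℕ) : Valid α (D.kinds x) where
  zero := rfl
  below n := by
    classical
    rcases n with _ | n
    · trivial
    · rw [kinds_succ]
      split_ifs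
      · exact D.below _
      · trivial
  legal n := by
    classical
    rw [kinds_succ]
    split_ifs with h
    · exact h
    · trivial

theorem kinds_congr {x x' : ℕ → ℕ} {v : ℕ} (h : ∀ k < v, x k = x' k) :
    D.kinds x v = D.kinds x' v := by
  have : ∀ n ≤ v, D.partialKinds x n = D.partialKinds x' n := by
    intro n hn
    induction n with
    | zero => rfl
    | succ n ih =>
      rw [partialKinds, partialKinds, ih (by omega), h n (by omega)]
  rw [kinds, this v le_rfl, kinds]

/-- The kinds coded by a finite sequence followed by pushes. -/
noncomputable def listKinds (l : List ℕ) : ℕ → Kind.{u} := D.kinds fun k => l.getD k D.pushCode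

/-- The sequence `x` extends the list `l`. -/
def Extends (l : List ℕ) (x : ℕ → ℕ) : Prop := ∀ n < l.length, x n = l.getD n D.pushCode

variable {D}

theorem Extends.kinds_eq {l : List ℕ} {x : ℕ → ℕ} (h : D.Extends l x) {v : ℕ}
    (hv : v ≤ l.length) : D.listKinds l v = D.kinds x v :=
  D.kinds_congr fun k hk => (h k (by omega)).symm

theorem getD_prefix_eq {l l' : List ℕ} (h : l <+: l') {n : ℕ} (hn : n < l.length) (d : ℕ) :
    l'.getD n d = l.getD n d := by
  obtain ⟨t, rfl⟩ := h
  exact List.getD_append _ _ _ _ hn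

theorem listKinds_prefix_eq {l l' : List ℕ} (h : l <+: l') {v : ℕ} (hv : v ≤ l.length) :
    D.listKinds l v = D.listKinds l' v :=
  Extends.kinds_eq (fun _ hn => getD_prefix_eq h hn _) hv

theorem listKinds_concat {l : List ℕ} {c : ℕ} (h : Legal (D.listKinds l) l.length (D.dec c)) :
    D.listKinds (l ++ [c]) (l.length + 1) = D.dec c := by
  have hc : (l ++ [c]).getD l.length D.pushCode = c := by
    rw [List.getD_append_right _ _ _ _ le_rfl]
    simp
  have := D.kinds_succ_of_legal (x := fun k => (l ++ [c]).getD k D.pushCode) (n := l.length) (by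
    rw [hc]
    exact h.congr fun v hv => listKinds_prefix_eq (List.prefix_append _ _) hv)
  rw [hc] at this
  exact this

variable (D)

/-- `l'` extends `l` in such a way that the last stage of `l` is reachable from that of `l'`. -/
def Ext (l l' : List ℕ) : Prop := l <+: l' ∧ Rch (D.listKinds l') l.length l'.length

variable {D}

theorem Ext.refl (l : List ℕ) : D.Ext l l := ⟨List.prefix_refl l, .refl _⟩

theorem Ext.trans {l l' l'' : List ℕ} (h : D.Ext l l') (h' : D.Ext l' l'') : D.Ext l l'' :=
  ⟨h.1.trans h'.1, (h.2.congr fun _ hv => listKinds_prefix_eq h'.1 hv).trans h'.2⟩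

theorem Ext.push (l : List ℕ) : D.Ext l (l ++ [D.pushCode]) := by
  refine ⟨List.prefix_append _ _, ?_⟩
  have h := listKinds_concat (D := D) (l := l) (c := D.pushCode) (by rw [dec_pushCode]; trivial)
  rw [dec_pushCode] at h
  have hp : par (D.listKinds (l ++ [D.pushCode])) (l.length + 1) = l.length := by
    simp [par, h]
  rw [List.length_append, List.length_singleton]
  refine .step (by omega) (by simp [h, IsSplit]) ?_
  rw [hp]
  exact .refl _

variable (D)

/-- The proper extension of `l` coded by `m`. -/
noncomputable def next (l : List ℕ) (m : ℕ) : List ℕ :=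
  open Classical in
  if l.length < (l ++ Denumerable.ofNat (List ℕ) m).length ∧ D.Ext l (l ++ Denumerable.ofNat (List ℕ) m)
  then l ++ Denumerable.ofNat (List ℕ) m else l ++ [D.pushCode]

theorem ext_next (l : List ℕ) (m : ℕ) : D.Ext l (D.next l m) := by
  unfold next
  split_ifs with h
  · exact h.2
  · exact Ext.push l

theorem length_lt_next (l : List ℕ) (m : ℕ) : l.length < (D.next l m).length := by
  unfold next
  split_ifs with h
  · exact h.1
  · simp

theorem exists_next {l l' : List ℕ} (h : D.Ext l l') (hlt : l.length < l'.length) :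
    ∃ m, D.next l m = l' := by
  obtain ⟨t, rfl⟩ := h.1
  refine ⟨Encodable.encode t, ?_⟩
  unfold next
  rw [Denumerable.ofNat_encode, if_pos ⟨hlt, h⟩]

/-- The increasing sequence of lists starting from `p` coded by `g`. -/
noncomputable def path (p : List ℕ) (g : ℕ → ℕ) : ℕ → List ℕ
  | 0 => p
  | k + 1 => D.next (path p g k) (g k)

variable {D}

theorem path_ext (p : List ℕ) (g : ℕ → ℕ) {k k' : ℕ} (h : k ≤ k') :
    D.Ext (D.path p g k) (D.path p g k') := by
  induction k', h using Nat.le_induction with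
  | base => exact Ext.refl _
  | succ k' _ ih => exact ih.trans (D.ext_next _ _)

theorem length_path_strictMono (p : List ℕ) (g : ℕ → ℕ) :
    StrictMono fun k => (D.path p g k).length :=
  strictMono_nat_of_lt_succ fun _ => D.length_lt_next _ _

theorem path_congr {p : List ℕ} {g g' : ℕ → ℕ} {k : ℕ} (h : ∀ n < k, g n = g' n) :
    D.path p g k = D.path p g' k := by
  induction k with
  | zero => rfl
  | succ k ih => rw [path, path, ih fun n hn => h n (by omega), h k (by omega)]

variable (D)

/-- The limit of the lists coded by `g`. -/
noncomputable def limit (p : List ℕ) (g : ℕ → ℕ) (n : ℕ) : ℕ :=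
  (D.path p g (n + 1)).getD n D.pushCode

variable {D}

theorem limit_extends (p : List ℕ) (g : ℕ → ℕ) (k : ℕ) :
    D.Extends (D.path p g k) (D.limit p g) := by
  intro n hn
  have hn' : n < (D.path p g (n + 1)).length := (length_path_strictMono p g).le_apply (x := n + 1)
  unfold limit
  rcases le_total k (n + 1) with h | h
  · exact getD_prefix_eq (path_ext p g h).1 hn _
  · exact (getD_prefix_eq (path_ext p g h).1 hn' _).symm

theorem exists_limitBranch (p : List ℕ) (g : ℕ → ℕ) (i : Bool) :
    ∃ y, IsBranch (D.kinds (D.limit p g)) y ∧ ∀ k, st (D.path p g k).length i ∈ Set.range y := by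
  have V := D.valid_kinds (D.limit p g)
  have hmono : StrictMono fun k => st (D.path p g k).length i :=
    fun a b h => st_lt_st (length_path_strictMono p g h) i i
  obtain ⟨y, hy, h⟩ := V.exists_isBranch (T := Set.range fun k => st (D.path p g k).length i)
    (Set.infinite_range_of_injective hmono.injective) (by
      rintro _ ⟨a, rfl⟩ _ ⟨b, rfl⟩ hab
      exact V.anc_stPar ((path_ext p g (hmono.le_iff_le.1 hab)).2.congr fun v hv =>
        (limit_extends p g b).kinds_eq hv) i)
  refine ⟨y, hy, fun k => ?_⟩
  rw [h]
  exact ⟨_, ⟨k, rfl⟩, .refl _⟩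

variable (D)

/-- The branch through all states of bit `i` at the stages of the path coded by `g`. -/
noncomputable def limitBranch (p : List ℕ) (i : Bool) (g : ℕ → ℕ) : ℕ → ℕ :=
  (exists_limitBranch (D := D) p g i).choose

/-- A sequence of codes together with a branch. -/
noncomputable def generic (p : List ℕ) (i : Bool) (g : ℕ → ℕ) : (ℕ → ℕ) × (ℕ → ℕ) :=
  (D.limit p g, D.limitBranch p i g)

variable {D}

theorem isBranch_limitBranch (p : List ℕ) (i : Bool) (g : ℕ → ℕ) :
    IsBranch (D.kinds (D.limit p g)) (D.limitBranch p i g) :=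
  (exists_limitBranch p g i).choose_spec.1

theorem mem_limitBranch (p : List ℕ) (i : Bool) (g : ℕ → ℕ) (k : ℕ) :
    st (D.path p g k).length i ∈ Set.range (D.limitBranch p i g) :=
  (exists_limitBranch p g i).choose_spec.2 k

theorem limitBranch_ne (p : List ℕ) (g : ℕ → ℕ) :
    D.limitBranch p false g ≠ D.limitBranch p true g := by
  intro h
  have h₁ := mem_limitBranch (D := D) p false g 0
  have h₂ := mem_limitBranch (D := D) p true g 0
  rw [h] at h₁
  have := congrArg bit ((isBranch_limitBranch p true g).eq_of_div_eq h₁ h₂ (by simp))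
  simp at this

/-- A branch through the state at the end of the `k`-th list agrees up to index `k` with the limit
branch. -/
theorem eq_limitBranch {p : List ℕ} {i : Bool} {g : ℕ → ℕ} {k : ℕ} {x y : ℕ → ℕ}
    (hx : D.Extends (D.path p g k) x) (hy : IsBranch (D.kinds x) y)
    (h : st (D.path p g k).length i ∈ Set.range y) :
    ∀ n ≤ k, y n = D.limitBranch p i g n := by
  have hz := isBranch_limitBranch (D := D) p i g
  choose a ha using mem_limitBranch (D := D) p i g
  obtain ⟨b, hb⟩ := h
  have hmono : StrictMono a := fun m n hmn => by
    rw [← hz.strictMono.lt_iff_lt, ha, ha]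
    exact st_lt_st (length_path_strictMono p g hmn) i i
  have key := hz.eq_below hy ((ha k).trans hb.symm) fun v hv => by
    rw [ha, st_div] at hv
    rw [← hx.kinds_eq hv, ← (limit_extends p g k).kinds_eq hv]
  exact fun n hn => (key n (hn.trans hmono.le_apply)).symm

theorem path_shift (p : List ℕ) (g₀ g : ℕ → ℕ) (N k : ℕ) :
    D.path p (fun n => if n < N then g₀ n else g (n - N)) (k + N) = D.path (D.path p g₀ N) g k := by
  induction k with
  | zero =>
    rw [Nat.zero_add]
    exact path_congr fun n hn => if_pos hn
  | succ k ih =>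
    rw [Nat.add_right_comm, path, ih, path, if_neg (by omega), Nat.add_sub_cancel]

theorem generic_shift (p : List ℕ) (i : Bool) (g₀ g : ℕ → ℕ) (N : ℕ) :
    D.generic p i (fun n => if n < N then g₀ n else g (n - N)) =
      D.generic (D.path p g₀ N) i g := by
  set f : ℕ → ℕ := fun n => if n < N then g₀ n else g (n - N) with hf
  have hpath := fun k => path_shift (D := D) p g₀ g N k
  rw [← hf] at hpath
  have hlim : D.limit p f = D.limit (D.path p g₀ N) g := by
    funext n
    have h₁ := length_path_strictMono (D := D) p f |>.le_apply (x := n + 1 + N)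
    have h₂ := limit_extends (D := D) p f (n + 1 + N) n (by omega)
    rw [hpath] at h₂
    exact h₂
  have hbr : D.limitBranch p i f = D.limitBranch (D.path p g₀ N) i g := by
    funext n
    refine eq_limitBranch (k := n) ?_ (isBranch_limitBranch p i f) ?_ n le_rfl
    · rw [hlim]
      exact limit_extends _ _ _
    · rw [← hpath]
      exact mem_limitBranch _ _ _ _
  rw [generic, generic, hlim, hbr]

end Coding

end Codings

section Topology

open Filter Topology

theorem isOpen_agree (x : ℕ → ℕ) (n : ℕ) : IsOpen {z : ℕ → ℕ | ∀ k < n, z k = x k} := by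
  have : {z : ℕ → ℕ | ∀ k < n, z k = x k} = ⋂ k ∈ Set.Iio n, (fun z : ℕ → ℕ => z k) ⁻¹' {x k} := by
    ext z
    simp
  rw [this]
  exact (Set.finite_Iio n).isOpen_biInter fun k _ =>
    (isOpen_discrete _).preimage (continuous_apply k)

theorem exists_agree_subset {U : Set (ℕ → ℕ)} (hU : IsOpen U) {x : ℕ → ℕ} (hx : x ∈ U) :
    ∃ n, ∀ z : ℕ → ℕ, (∀ k < n, z k = x k) → z ∈ U := by
  obtain ⟨I, u, hu, hsub⟩ := isOpen_pi_iff.1 hU x hx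
  obtain ⟨n, hn⟩ := I.bddAbove
  refine ⟨n + 1, fun z hz => hsub fun k hk => ?_⟩
  rw [hz k (Nat.lt_succ_iff.2 (hn hk))]
  exact (hu k hk).2

theorem exists_agree_subset_prod {U : Set ((ℕ → ℕ) × (ℕ → ℕ))} (hU : IsOpen U)
    {p : (ℕ → ℕ) × (ℕ → ℕ)} (hp : p ∈ U) :
    ∃ n, ∀ q : (ℕ → ℕ) × (ℕ → ℕ), (∀ k < n, q.1 k = p.1 k) → (∀ k < n, q.2 k = p.2 k) →
      q ∈ U := by
  obtain ⟨u, v, hu, hv, h₁, h₂, hsub⟩ := isOpen_prod_iff.1 hU p.1 p.2 hp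
  obtain ⟨a, ha⟩ := exists_agree_subset hu h₁
  obtain ⟨b, hb⟩ := exists_agree_subset hv h₂
  exact ⟨max a b, fun q hq₁ hq₂ => hsub ⟨ha _ fun k hk => hq₁ k (lt_max_of_lt_left hk),
    hb _ fun k hk => hq₂ k (lt_max_of_lt_right hk)⟩⟩

theorem continuous_of_agree {f : (ℕ → ℕ) → ℕ → ℕ}
    (hf : ∀ g g' : ℕ → ℕ, ∀ n, (∀ k < n + 1, g' k = g k) → f g' n = f g n) : Continuous f := by
  refine continuous_pi fun n => continuous_iff_continuousAt.2 fun g => ?_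
  refine ContinuousAt.congr (f := fun _ => f g n) continuousAt_const ?_
  filter_upwards [(isOpen_agree g (n + 1)).mem_nhds fun _ _ => rfl] with g' hg'
  exact (hf g g' n hg').symm

theorem continuous_shift (g₀ : ℕ → ℕ) (N : ℕ) :
    Continuous fun (g : ℕ → ℕ) n => if n < N then g₀ n else g (n - N) :=
  continuous_of_agree fun g g' n h => by
    split_ifs
    · rfl
    · exact h _ (by omega)

theorem isOpenMap_shift (g₀ : ℕ → ℕ) (N : ℕ) :
    IsOpenMap fun (g : ℕ → ℕ) n => if n < N then g₀ n else g (n - N) := by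
  intro U hU
  have : (fun (g : ℕ → ℕ) n => if n < N then g₀ n else g (n - N)) '' U =
      {z | ∀ k < N, z k = g₀ k} ∩ (fun (z : ℕ → ℕ) k => z (k + N)) ⁻¹' U := by
    ext z
    constructor
    · rintro ⟨g, hg, rfl⟩
      refine ⟨fun k hk => if_pos hk, ?_⟩
      simpa using hg
    · rintro ⟨h₁, h₂⟩
      refine ⟨_, h₂, ?_⟩
      funext n
      dsimp only
      split_ifs with h
      · exact (h₁ n h).symm
      · rw [Nat.sub_add_cancel (not_lt.1 h)]
  rw [this]
  exact (isOpen_agree g₀ N).inter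
    (hU.preimage (continuous_pi fun k => continuous_apply (k + N)))

theorem nonempty_of_mem_residual {S : Set (ℕ → ℕ)} (h : S ∈ residual (ℕ → ℕ)) : S.Nonempty :=
  (dense_of_mem_residual h).nonempty

theorem Sigma0.measurableSet {δ : Ordinal.{u}} {A : Set ((ℕ → ℕ) × (ℕ → ℕ))}
    (h : A ∈ Sigma0 ((ℕ → ℕ) × (ℕ → ℕ)) δ) : MeasurableSet A := by
  induction δ using WellFoundedLT.induction generalizing A with
  | _ δ ih =>
    rw [Sigma0] at h
    rcases h with ⟨_, h⟩ | ⟨_, B, β, hB, rfl⟩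
    · exact h.measurableSet
    · refine MeasurableSet.iUnion fun n => ?_
      obtain ⟨_, hb, h⟩ := hB n
      exact (ih _ hb h).compl

namespace Coding

variable {α : Ordinal.{u}} (D : Coding α)

/-- The set of pairs of a sequence and one of its branches. -/
def branchSet : Set ((ℕ → ℕ) × (ℕ → ℕ)) := {p | IsBranch (D.kinds p.1) p.2}

theorem isClosed_branchSet : IsClosed D.branchSet := by
  rw [← isOpen_compl_iff, isOpen_iff_forall_mem_open]
  intro p hp
  have hclopen : ∀ n, IsOpen {q : (ℕ → ℕ) × (ℕ → ℕ) |
      (∀ k < n, q.1 k = p.1 k) ∧ ∀ k < n, q.2 k = p.2 k} := fun n =>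
    ((isOpen_agree p.1 n).preimage continuous_fst).inter
      ((isOpen_agree p.2 n).preimage continuous_snd)
  have hp' : ¬ (p.2 0 < 2 ∧ ∀ k, p.2 k / 2 < p.2 (k + 1) / 2 ∧
    stPar (D.kinds p.1) (p.2 (k + 1)) = p.2 k) := hp
  rw [not_and_or, not_forall] at hp'
  rcases hp' with h | ⟨k, h⟩
  · refine ⟨_, fun q hq hqb => ?_, hclopen 1, fun _ _ => rfl, fun _ _ => rfl⟩
    rw [← hq.2 0 (by omega)] at h
    exact h hqb.1
  · refine ⟨_, fun q hq hqb => ?_, hclopen (p.2 (k + 1) + k + 2), fun _ _ => rfl, fun _ _ => rfl⟩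
    have := hqb.2 k
    rw [hq.2 k (by omega), hq.2 (k + 1) (by omega)] at this
    refine h ⟨this.1, ?_⟩
    rw [← this.2]
    unfold stPar
    rw [D.kinds_congr (x := p.1) (x' := q.1) fun v hv => (hq.1 v (by omega)).symm]

variable {D}

theorem generic_agree {p : List ℕ} {i : Bool} {g g' : ℕ → ℕ} {n : ℕ}
    (h : ∀ k < n + 1, g' k = g k) : (D.generic p i g').1 n = (D.generic p i g).1 n ∧
      (D.generic p i g').2 n = (D.generic p i g).2 n := by
  refine ⟨?_, ?_⟩
  · change D.limit p g' n = D.limit p g n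
    rw [limit, limit, path_congr h]
  · have hp := path_congr (D := D) (p := p) (k := n) fun k hk => h k (by omega)
    refine eq_limitBranch (k := n) ?_ (isBranch_limitBranch p i g') ?_ n le_rfl
    · rw [← hp]
      exact limit_extends p g' n
    · rw [← hp]
      exact mem_limitBranch p i g' n

theorem continuous_generic (p : List ℕ) (i : Bool) : Continuous (D.generic p i) :=
  (continuous_of_agree fun _ _ _ h => (generic_agree (p := p) (i := i) h).1).prodMk
    (continuous_of_agree fun _ _ _ h => (generic_agree (p := p) (i := i) h).2)

variable (D)

/-- The generic pairs above `p` with bit `i` lie in `A`. -/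
def Forces (p : List ℕ) (i : Bool) (A : Set ((ℕ → ℕ) × (ℕ → ℕ))) : Prop :=
  D.generic p i ⁻¹' A ∈ residual (ℕ → ℕ)

variable {D} {p q r : List ℕ} {i j : Bool} {A : Set ((ℕ → ℕ) × (ℕ → ℕ))}

theorem Forces.mono_set {A' : Set ((ℕ → ℕ) × (ℕ → ℕ))} (h : D.Forces p i A) (hA : A ⊆ A') :
    D.Forces p i A' := mem_of_superset h (Set.preimage_mono hA)

theorem Forces.path (h : D.Forces p i A) (g₀ : ℕ → ℕ) (N : ℕ) :
    D.Forces (D.path p g₀ N) i A := by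
  have := tendsto_residual_of_isOpenMap (continuous_shift g₀ N) (isOpenMap_shift g₀ N) h
  rw [mem_map, ← Set.preimage_comp] at this
  have hcomp : (D.generic p i ∘ fun (g : ℕ → ℕ) n => if n < N then g₀ n else g (n - N)) =
      D.generic (D.path p g₀ N) i := funext fun g => generic_shift p i g₀ g N
  rwa [hcomp] at this

theorem Forces.ext (h : D.Forces p i A) (hpq : D.Ext p q) : D.Forces q i A := by
  rcases hpq.1.length_le.eq_or_lt with hlen | hlen
  · rwa [← hpq.1.eq_of_length hlen]
  · obtain ⟨m, rfl⟩ := D.exists_next hpq hlen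
    exact h.path (fun _ => m) 1

theorem Forces.not_compl (h : D.Forces p i A) : ¬ D.Forces p i Aᶜ := fun h' => by
  obtain ⟨g, h₁, h₂⟩ := nonempty_of_mem_residual (inter_mem h h')
  exact h₂ h₁

theorem exists_forces_compl {B : ℕ → Set ((ℕ → ℕ) × (ℕ → ℕ))} (hB : ∀ n, MeasurableSet (B n))
    (h : ¬ D.Forces p i (⋂ n, B n)) : ∃ n, ∃ q, D.Ext p q ∧ D.Forces q i (B n)ᶜ := by
  unfold Forces at h
  rw [Set.preimage_iInter, countable_iInter_mem, not_forall] at h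
  obtain ⟨n, hn⟩ := h
  obtain ⟨U, hU, hSU⟩ := ((hB n).preimage (continuous_generic p i).measurable).compl.residualEq_isOpen
  rcases U.eq_empty_or_nonempty with rfl | ⟨g₀, hg₀⟩
  · refine absurd ?_ hn
    filter_upwards [hSU] with g hg
    by_contra hgn
    exact (Set.mem_empty_iff_false g).1 (hg.mp hgn)
  obtain ⟨N, hN⟩ := exists_agree_subset hU hg₀
  refine ⟨n, D.path p g₀ N, path_ext p g₀ (Nat.zero_le N), ?_⟩
  have := tendsto_residual_of_isOpenMap (continuous_shift g₀ N) (isOpenMap_shift g₀ N) hSU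
  rw [mem_map] at this
  unfold Forces
  filter_upwards [this] with g hg
  have hg' := hg.mpr (hN _ fun k hk => if_pos hk)
  change D.generic p i _ ∈ (B n)ᶜ at hg'
  rwa [generic_shift] at hg'

/-- If a generic pair lies in an open set, so does every generic pair through a one-step extension
of some initial segment. -/
theorem exists_generic_mem {g : ℕ → ℕ} (hA : IsOpen A) (hg : D.generic p i g ∈ A) :
    ∃ n, ∀ c j l, Lab (D.listKinds (D.path p g n ++ [c])) ((D.path p g n).length + 1) j i l →
      ∀ g', D.generic (D.path p g n ++ [c]) j g' ∈ A := by
  obtain ⟨n, hn⟩ := exists_agree_subset_prod hA hg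
  refine ⟨n, fun c j l hl g' => ?_⟩
  have hpre : D.path p g n <+: D.path p g n ++ [c] := List.prefix_append _ _
  have hlim := limit_extends (D := D) (D.path p g n ++ [c]) g' 0
  have hlim' : D.Extends (D.path p g n) (D.limit (D.path p g n ++ [c]) g') := fun k hk => by
    rw [← getD_prefix_eq hpre hk]
    exact hlim k (hk.trans_le hpre.length_le)
  have hbr := isBranch_limitBranch (D := D) (D.path p g n ++ [c]) j g'
  have hmem := (hbr.branch (D.valid_kinds _)).closed _
    (mem_limitBranch (D := D) (D.path p g n ++ [c]) j g' 0)
  have hlen : (D.path p g n ++ [c]).length = (D.path p g n).length + 1 := by simp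
  change stPar _ (st (D.path p g n ++ [c]).length j) ∈ _ at hmem
  rw [hlen, stPar_of_lab (hl.congr (hlim.kinds_eq hlen.ge)), Nat.add_sub_cancel] at hmem
  refine hn _ (fun k hk => ?_) fun k hk => eq_limitBranch hlim' hbr hmem k hk.le
  have hk' : k < (D.path p g n).length :=
    hk.trans_le ((length_path_strictMono (D := D) p g).le_apply (x := n))
  exact (hlim' k hk').trans (limit_extends p g n k hk').symm

variable (D) in
/-- The step after `p` links the bit `j` above to the bit `i` below with label at least `δ`, and
`q` lies above this step. -/
def Linked (p : List ℕ) (i : Bool) (q : List ℕ) (j : Bool) (δ : Ordinal.{u}) : Prop :=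
  p <+: q ∧ p.length + 1 ≤ q.length ∧ Rch (D.listKinds q) (p.length + 1) q.length ∧
    ∃ l, δ ≤ l ∧ Lab (D.listKinds q) (p.length + 1) j i l

theorem Linked.ext {δ : Ordinal.{u}} (h : D.Linked p i q j δ) (hqr : D.Ext q r) :
    D.Linked p i r j δ := by
  obtain ⟨h₁, h₂, h₃, l, hl, hlab⟩ := h
  exact ⟨h₁.trans hqr.1, h₂.trans hqr.1.length_le,
    (h₃.congr fun v hv => listKinds_prefix_eq hqr.1 hv).trans hqr.2, l, hl,
    hlab.congr (listKinds_prefix_eq hqr.1 h₂)⟩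

/-- A link can be undone, with any smaller label. -/
theorem Linked.exists_undo {δ ε : Ordinal.{u}} (h : D.Linked p i q j δ) (hε : ε < δ) :
    ∃ c, D.Ext p (q ++ [c]) ∧ D.Linked q j (q ++ [c]) i ε ∧
      Lab (D.listKinds (q ++ [c])) (q.length + 1) i j ε := by
  obtain ⟨h₁, h₂, h₃, l, hl, hlab⟩ := h
  have hlα : l < α := by
    have := (D.valid_kinds fun k => q.getD k D.pushCode).below (p.length + 1)
    change (D.listKinds q _).Below α at this
    rcases hlab with hlab | ⟨_, hlab⟩ <;> rwa [hlab] at this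
  obtain ⟨c, hc⟩ := D.exists_code (k := undo (p.length + 1) i j ε) ((hε.trans_le hl).trans hlα)
  have hk := listKinds_concat (D := D) (l := q) (c := c) (by
    rw [hc]
    exact ⟨by omega, h₂, h₃, l, hlab, hε.trans_le hl⟩)
  rw [hc] at hk
  have hlab' : Lab (D.listKinds (q ++ [c])) (q.length + 1) i j ε := .inr ⟨_, hk⟩
  have hlen : (q ++ [c]).length = q.length + 1 := by simp
  have hpar : par (D.listKinds (q ++ [c])) (q.length + 1) = p.length := by simp [par, hk]
  refine ⟨c, ⟨h₁.trans (List.prefix_append _ _), ?_⟩,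
    ⟨List.prefix_append _ _, hlen.ge, ?_, ε, le_rfl, hlab'⟩, hlab'⟩
  · rw [hlen]
    refine .step (by omega) (by simp [hk, IsSplit]) ?_
    rw [hpar]
    exact .refl _
  · rw [hlen]
    exact .refl _

theorem Linked.forces_compl {δ : Ordinal.{u}} (hA : A ∈ Sigma0 ((ℕ → ℕ) × (ℕ → ℕ)) δ)
    (h : D.Linked p i q j δ) (hp : D.Forces p i Aᶜ) : D.Forces q j Aᶜ := by
  induction δ using WellFoundedLT.induction generalizing A p i q j with
  | _ δ ih =>
    rw [Sigma0] at hA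
    rcases hA with ⟨rfl, hA⟩ | ⟨_, B, β, hB, rfl⟩
    · refine Filter.univ_mem' fun g hg => ?_
      obtain ⟨n, hn⟩ := exists_generic_mem hA hg
      obtain ⟨c, hext, _, hlab⟩ :=
        (h.ext (path_ext q g (Nat.zero_le n))).exists_undo zero_lt_one
      exact (hp.ext hext).not_compl (univ_mem' fun g' => by
        rw [compl_compl]
        exact hn c i 0 hlab g')
    · rw [Set.compl_iUnion] at hp ⊢
      simp only [compl_compl] at hp ⊢
      by_contra hq
      obtain ⟨n, r, hqr, hr⟩ := exists_forces_compl (fun n => by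
        obtain ⟨_, _, h⟩ := hB n
        exact Sigma0.measurableSet h) hq
      obtain ⟨_, hβ, hBn⟩ := hB n
      obtain ⟨c, hext, hlink, _⟩ := (h.ext hqr).exists_undo hβ
      exact ((hp.mono_set (Set.iInter_subset B n)).ext hext).not_compl (ih _ hβ hBn hlink hr)

/-- Above any list reachable from the root, both branches can be merged with any label. -/
theorem exists_split (hp : D.Ext [] p) (i : Bool) {l : Ordinal.{u}} (hl : l < α) :
    ∃ c, ∀ j, Lab (D.listKinds (p ++ [c])) (p.length + 1) j i l ∧
      D.Linked p i (p ++ [c]) j l := by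
  obtain ⟨c, hc⟩ := D.exists_code (k := split i l) hl
  have hk := listKinds_concat (D := D) (l := p) (c := c) (by
    rw [hc]
    exact hp.2)
  rw [hc] at hk
  have hlen : (p ++ [c]).length = p.length + 1 := by simp
  refine ⟨c, fun j => ⟨.inl hk, List.prefix_append _ _, hlen.ge, ?_, l, le_rfl, .inl hk⟩⟩
  rw [hlen]
  exact .refl _

theorem not_exists_uniformization (D : Coding α) (f : (ℕ → ℕ) → ℕ → ℕ)
    (hf : {p : (ℕ → ℕ) × (ℕ → ℕ) | p.2 = f p.1} ⊆ D.branchSet) :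
    {p : (ℕ → ℕ) × (ℕ → ℕ) | p.2 = f p.1} ∉ Sigma0 ((ℕ → ℕ) × (ℕ → ℕ)) α := by
  intro hG
  have hgraph : ∀ p : (ℕ → ℕ) × (ℕ → ℕ), p ∈ {p : (ℕ → ℕ) × (ℕ → ℕ) | p.2 = f p.1} ↔
      p.2 = f p.1 := fun p => Iff.rfl
  have hone : ∀ p g, ¬ ∀ j, D.generic p j g ∈ {p : (ℕ → ℕ) × (ℕ → ℕ) | p.2 = f p.1} :=
    fun p g h => limitBranch_ne p g (((hgraph _).1 (h false)).trans ((hgraph _).1 (h true)).symm)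
  have hsome : ∀ g, ∃ i, D.generic [] i g ∈ {p : (ℕ → ℕ) × (ℕ → ℕ) | p.2 = f p.1} := by
    intro g
    obtain ⟨y, z, hyz, hpair⟩ := (D.valid_kinds (D.limit [] g)).exists_pair
    have hmem : ∀ w, IsBranch (D.kinds (D.limit [] g)) w → w = y ∨ w = z := fun w hw => hpair.le hw
    have h₁ := hmem _ (isBranch_limitBranch [] false g)
    have h₂ := hmem _ (isBranch_limitBranch [] true g)
    have h₃ := hmem (f (D.limit [] g)) (hf (a := (D.limit [] g, f (D.limit [] g))) rfl)
    have h₄ := limitBranch_ne (D := D) [] g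
    have : D.limitBranch [] false g = f (D.limit [] g) ∨
        D.limitBranch [] true g = f (D.limit [] g) := by
      rcases h₁ with h₁ | h₁ <;> rcases h₂ with h₂ | h₂ <;> rcases h₃ with h₃ | h₃ <;> simp_all
    rcases this with h | h
    · exact ⟨false, h⟩
    · exact ⟨true, h⟩
  generalize {p : (ℕ → ℕ) × (ℕ → ℕ) | p.2 = f p.1} = G at *
  rw [Sigma0] at hG
  rcases hG with ⟨rfl, hG⟩ | ⟨_, B, β, hB, rfl⟩
  · obtain ⟨i, hi⟩ := hsome 0
    obtain ⟨n, hn⟩ := exists_generic_mem hG hi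
    obtain ⟨c, hc⟩ := exists_split (path_ext [] 0 (Nat.zero_le n)) i (zero_lt_one' Ordinal.{u})
    exact hone _ 0 fun j => hn c j 0 (hc j).1 0
  · have hi : ∃ i, ¬ D.Forces [] i (⋂ n, B n) := by
      by_contra! h
      obtain ⟨g, h₁, h₂⟩ := nonempty_of_mem_residual (inter_mem (h false) (h true))
      obtain ⟨i, hi⟩ := hsome g
      rw [← Set.compl_iInter] at hi
      cases i
      · exact hi h₁
      · exact hi h₂
    obtain ⟨i, hi⟩ := hi
    obtain ⟨n, p, hp, hforce⟩ := exists_forces_compl (fun n => by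
      obtain ⟨_, _, h⟩ := hB n
      exact Sigma0.measurableSet h) hi
    obtain ⟨_, hβ, hBn⟩ := hB n
    obtain ⟨c, hc⟩ := exists_split hp i hβ
    have hj := fun j => (hc j).2.forces_compl hBn hforce
    obtain ⟨g, h₁, h₂⟩ := nonempty_of_mem_residual (inter_mem (hj false) (hj true))
    refine hone (p ++ [c]) g fun j => Set.mem_iUnion.2 ⟨n, ?_⟩
    cases j
    · exact h₁
    · exact h₂

end Coding

end Topology

/-- For every countable ordinal `α ≥ 1` there is a closed set `F ⊆ ω^ω × ω^ω` with all
sections two-point sets containing no `Σ⁰_α` graph of a function `ω^ω → ω^ω`. -/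
theorem no_Sigma0_alpha_uniformizing_graph
    (α : Ordinal) (hα1 : 1 ≤ α) (hα2 : α < (Cardinal.aleph 1).ord) :
    ∃ F : Set ((ℕ → ℕ) × (ℕ → ℕ)),
      IsClosed F ∧
      (∀ x : ℕ → ℕ, ∃ y z : ℕ → ℕ, y ≠ z ∧ {v : ℕ → ℕ | (x, v) ∈ F} = {y, z}) ∧
      ¬ ∃ f : (ℕ → ℕ) → (ℕ → ℕ),
          {p : (ℕ → ℕ) × (ℕ → ℕ) | p.2 = f p.1} ⊆ F ∧
          {p : (ℕ → ℕ) × (ℕ → ℕ) | p.2 = f p.1} ∈ Sigma0 ((ℕ → ℕ) × (ℕ → ℕ)) α := by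
  obtain ⟨D⟩ := Coding.nonempty hα2
  refine ⟨D.branchSet, D.isClosed_branchSet, fun x => (D.valid_kinds x).exists_pair, ?_⟩
  rintro ⟨f, hf, hG⟩
  exact D.not_exists_uniformization f hf hG
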